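/- arXiv:q-alg/9504013 — 4 statements merged into one kernel-verified Lean document; each statement's English description precedes it below -/
import Mathlib

section
/- Fix an integer n ≥ 3 and a nonzero q ∈ 𝕂. As endomorphisms of F, for all i, j ∈ ℤ (congruences modulo n): K_i K_j = K_j K_i; K_i E_j K_i^{−1} = q^{a_{ij}} E_j and K_i F_j K_i^{−1} = q^{−a_{ij}} F_j, where a_{ij} = 2[i ≡ j] − [i ≡ j+1] − [i ≡ j−1]; (q − q^{−1})·(E_i F_j − F_j E_i) = [i ≡ j]·(K_i − K_i^{−1}); if j ≡ i ± 1 then E_i²E_j − (q + q^{−1})E_iE_jE_i + E_jE_i² = 0 and F_i²F_j − (q + q^{−1})F_iF_jF_i + F_jF_i² = 0; and if j ≢ i, i+1, i−1 then E_iE_j = E_jE_i and F_iF_j = F_jF_i. In other words, the evaluation operators satisfy the defining relations of the quantum affine algebra U_q(ŝl_n), making F a level-0 representation. -/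
/-!
STATEMENT 4. The evaluation operators `E_i, F_i, K_i` on `F = ⊕_{m ∈ ℤ} 𝕂 v_m`
satisfy the defining relations of the quantum affine algebra `U_q(ŝl_n)` (n ≥ 3, q ≠ 0).
`F` is modeled as `ℤ →₀ 𝕂`, `v m = Finsupp.single m 1`; congruences mod `n` via `ZMod n`.
-/

noncomputable section

variable (𝕂 : Type*) [Field 𝕂] (n : ℕ) (q : 𝕂)

/-- `E_i · v_m = [m ≡ i+1 (mod n)] v_{m-1}`. -/
def Eop (i : ℤ) : (ℤ →₀ 𝕂) →ₗ[𝕂] (ℤ →₀ 𝕂) :=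
  Finsupp.lsum 𝕂 fun m : ℤ =>
    if ((m : ZMod n) = (i : ZMod n) + 1) then Finsupp.lsingle (m - 1) else 0

/-- `F_i · v_m = [m ≡ i (mod n)] v_{m+1}`. -/
def Fop (i : ℤ) : (ℤ →₀ 𝕂) →ₗ[𝕂] (ℤ →₀ 𝕂) :=
  Finsupp.lsum 𝕂 fun m : ℤ =>
    if ((m : ZMod n) = (i : ZMod n)) then Finsupp.lsingle (m + 1) else 0

/-- The diagonal exponent `[m ≡ i (mod n)] - [m ≡ i+1 (mod n)]`. -/
def hexp (i m : ℤ) : ℤ :=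
  (if (m : ZMod n) = (i : ZMod n) then 1 else 0) -
    (if (m : ZMod n) = (i : ZMod n) + 1 then 1 else 0)

/-- `K_i · v_m = q^{[m ≡ i (mod n)] - [m ≡ i+1 (mod n)]} v_m`. -/
def Kop (i : ℤ) : (ℤ →₀ 𝕂) →ₗ[𝕂] (ℤ →₀ 𝕂) :=
  Finsupp.lsum 𝕂 fun m : ℤ => (q ^ hexp n i m) • Finsupp.lsingle m

/-- The inverse `K_i^{-1} · v_m = q^{-([m ≡ i (mod n)] - [m ≡ i+1 (mod n)])} v_m`. -/
def Kinv (i : ℤ) : (ℤ →₀ 𝕂) →ₗ[𝕂] (ℤ →₀ 𝕂) :=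
  Finsupp.lsum 𝕂 fun m : ℤ => (q ^ (-hexp n i m)) • Finsupp.lsingle m

/-- The affine Cartan entries `a_{ij} = 2[i ≡ j] - [i ≡ j+1] - [i ≡ j-1]` (mod `n`). -/
def cartan (i j : ℤ) : ℤ :=
  2 * (if (i : ZMod n) = (j : ZMod n) then 1 else 0) -
    (if (i : ZMod n) = (j : ZMod n) + 1 then 1 else 0) -
    (if (i : ZMod n) = (j : ZMod n) - 1 then 1 else 0)

section EvaluationOperators

variable {𝕂 n q}

@[simp]
lemma Eop_single (i m : ℤ) (c : 𝕂) : Eop 𝕂 n i (Finsupp.single m c) =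
    if (m : ZMod n) = (i : ZMod n) + 1 then Finsupp.single (m - 1) c else 0 := by
  simp only [Eop, Finsupp.lsum_single]
  split_ifs <;> simp

@[simp]
lemma Fop_single (i m : ℤ) (c : 𝕂) : Fop 𝕂 n i (Finsupp.single m c) =
    if (m : ZMod n) = (i : ZMod n) then Finsupp.single (m + 1) c else 0 := by
  simp only [Fop, Finsupp.lsum_single]
  split_ifs <;> simp

@[simp]
lemma Kop_single (i m : ℤ) (c : 𝕂) :
    Kop 𝕂 n q i (Finsupp.single m c) = q ^ hexp n i m • Finsupp.single m c := by
  simp [Kop]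

@[simp]
lemma Kinv_single (i m : ℤ) (c : 𝕂) :
    Kinv 𝕂 n q i (Finsupp.single m c) = q ^ (-hexp n i m) • Finsupp.single m c := by
  simp [Kinv]

/-- Two consecutive `E` operators compose to zero unless the residues are consecutive. -/
lemma Eop_comp_Eop_eq_zero {i j : ℤ} (h : (j : ZMod n) ≠ (i : ZMod n) + 1) :
    Eop 𝕂 n i ∘ₗ Eop 𝕂 n j = 0 := by
  refine Finsupp.lhom_ext fun m c => ?_
  simp only [LinearMap.comp_apply, Eop_single, LinearMap.zero_apply]
  split_ifs with hm
  · simp [hm, h]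
  · simp

/-- Two consecutive `F` operators compose to zero unless the residues are consecutive. -/
lemma Fop_comp_Fop_eq_zero {i j : ℤ} (h : (i : ZMod n) ≠ (j : ZMod n) + 1) :
    Fop 𝕂 n i ∘ₗ Fop 𝕂 n j = 0 := by
  refine Finsupp.lhom_ext fun m c => ?_
  simp only [LinearMap.comp_apply, Fop_single, LinearMap.zero_apply]
  split_ifs with hm
  · simp [hm, h.symm]
  · simp

lemma Kop_comp_Kinv (hq : q ≠ 0) (i : ℤ) : Kop 𝕂 n q i ∘ₗ Kinv 𝕂 n q i = LinearMap.id := by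
  refine Finsupp.lhom_ext fun m c => ?_
  simp only [LinearMap.comp_apply, Kop_single, Kinv_single, map_smul, smul_smul, ← zpow_add₀ hq,
    neg_add_cancel, zpow_zero, one_smul, LinearMap.id_apply]

lemma Kinv_comp_Kop (hq : q ≠ 0) (i : ℤ) : Kinv 𝕂 n q i ∘ₗ Kop 𝕂 n q i = LinearMap.id := by
  refine Finsupp.lhom_ext fun m c => ?_
  simp only [LinearMap.comp_apply, Kop_single, Kinv_single, map_smul, smul_smul, ← zpow_add₀ hq,
    add_neg_cancel, zpow_zero, one_smul, LinearMap.id_apply]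

lemma Kop_comp_comm (i j : ℤ) : Kop 𝕂 n q i ∘ₗ Kop 𝕂 n q j = Kop 𝕂 n q j ∘ₗ Kop 𝕂 n q i := by
  refine Finsupp.lhom_ext fun m c => ?_
  simp only [LinearMap.comp_apply, Kop_single, map_smul]
  exact smul_comm _ _ _

lemma hexp_sub_one_sub_hexp {i j m : ℤ} (hm : (m : ZMod n) = (j : ZMod n) + 1) :
    hexp n i (m - 1) - hexp n i m = cartan n i j := by
  have h₁ : (j : ZMod n) = i ↔ (i : ZMod n) = j := eq_comm
  have h₂ : (j : ZMod n) = i + 1 ↔ (i : ZMod n) = j - 1 := by grind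
  have h₃ : (j : ZMod n) + 1 = i ↔ (i : ZMod n) = j + 1 := eq_comm
  simp only [hexp, cartan, Int.cast_sub, Int.cast_one, hm, add_sub_cancel_right, add_left_inj,
    h₁, h₂, h₃]
  ring

lemma hexp_add_one_sub_hexp {i j m : ℤ} (hm : (m : ZMod n) = (j : ZMod n)) :
    hexp n i (m + 1) - hexp n i m = -cartan n i j := by
  have h := hexp_sub_one_sub_hexp (n := n) (i := i) (m := m + 1) (j := j) (by simp [hm])
  rw [add_sub_cancel_right] at h
  rw [← h, neg_sub]

lemma Kop_comp_Eop_comp_Kinv (hq : q ≠ 0) (i j : ℤ) :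
    Kop 𝕂 n q i ∘ₗ Eop 𝕂 n j ∘ₗ Kinv 𝕂 n q i = (q ^ cartan n i j) • Eop 𝕂 n j := by
  refine Finsupp.lhom_ext fun m c => ?_
  simp only [LinearMap.comp_apply, LinearMap.smul_apply, Kinv_single, map_smul, Eop_single]
  split_ifs with hm
  · rw [Kop_single, smul_smul, ← zpow_add₀ hq, ← hexp_sub_one_sub_hexp hm, neg_add_eq_sub]
  · simp

lemma Kop_comp_Fop_comp_Kinv (hq : q ≠ 0) (i j : ℤ) :
    Kop 𝕂 n q i ∘ₗ Fop 𝕂 n j ∘ₗ Kinv 𝕂 n q i = (q ^ (-cartan n i j)) • Fop 𝕂 n j := by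
  refine Finsupp.lhom_ext fun m c => ?_
  simp only [LinearMap.comp_apply, LinearMap.smul_apply, Kinv_single, map_smul, Fop_single]
  split_ifs with hm
  · rw [Kop_single, smul_smul, ← zpow_add₀ hq, ← hexp_add_one_sub_hexp hm, neg_add_eq_sub]
  · simp

lemma Eop_comp_Fop_single (i j m : ℤ) (c : 𝕂) :
    Eop 𝕂 n i (Fop 𝕂 n j (Finsupp.single m c)) =
      if (m : ZMod n) = j ∧ (i : ZMod n) = j then Finsupp.single m c else 0 := by
  rw [Fop_single]
  by_cases hm : (m : ZMod n) = j
  · simp [hm, eq_comm]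
  · simp [hm]

lemma Fop_comp_Eop_single (i j m : ℤ) (c : 𝕂) :
    Fop 𝕂 n j (Eop 𝕂 n i (Finsupp.single m c)) =
      if (m : ZMod n) = (i : ZMod n) + 1 ∧ (i : ZMod n) = j then Finsupp.single m c else 0 := by
  rw [Eop_single]
  by_cases hm : (m : ZMod n) = (i : ZMod n) + 1
  · simp [hm]
  · simp [hm]

lemma Eop_Fop_commutator (h₁ : (1 : ZMod n) ≠ 0) (i j : ℤ) :
    (q - q⁻¹) • (Eop 𝕂 n i ∘ₗ Fop 𝕂 n j - Fop 𝕂 n j ∘ₗ Eop 𝕂 n i) =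
      if (i : ZMod n) = (j : ZMod n) then Kop 𝕂 n q i - Kinv 𝕂 n q i else 0 := by
  refine Finsupp.lhom_ext fun m c => ?_
  simp only [LinearMap.smul_apply, LinearMap.sub_apply, LinearMap.comp_apply,
    Eop_comp_Fop_single, Fop_comp_Eop_single]
  by_cases hij : (i : ZMod n) = j
  · simp only [hij, and_true, if_true, LinearMap.sub_apply, Kop_single, Kinv_single, hexp,
      ← sub_smul]
    by_cases hm : (m : ZMod n) = j
    · simp [hm, h₁, sub_smul]
    · by_cases hm' : (m : ZMod n) = (j : ZMod n) + 1
      · simp [hm', h₁, sub_smul]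
      · simp [hm, hm']
  · simp [hij]

lemma Eop_serre (h₁ : (1 : ZMod n) ≠ 0) (h₂ : (2 : ZMod n) ≠ 0) (c : 𝕂) (i j : ℤ) :
    Eop 𝕂 n i ∘ₗ Eop 𝕂 n i ∘ₗ Eop 𝕂 n j - c • (Eop 𝕂 n i ∘ₗ Eop 𝕂 n j ∘ₗ Eop 𝕂 n i) +
      Eop 𝕂 n j ∘ₗ Eop 𝕂 n i ∘ₗ Eop 𝕂 n i = 0 := by
  have hii : Eop 𝕂 n i ∘ₗ Eop 𝕂 n i = 0 := Eop_comp_Eop_eq_zero (by simpa using h₁)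
  have hiji : Eop 𝕂 n i ∘ₗ Eop 𝕂 n j ∘ₗ Eop 𝕂 n i = 0 := by
    by_cases h : (j : ZMod n) = (i : ZMod n) + 1
    · rw [Eop_comp_Eop_eq_zero (i := j) (j := i) (by grind), LinearMap.comp_zero]
    · rw [← LinearMap.comp_assoc, Eop_comp_Eop_eq_zero h, LinearMap.zero_comp]
  rw [hiji, hii, ← LinearMap.comp_assoc, hii, LinearMap.zero_comp, LinearMap.comp_zero, smul_zero,
    add_zero]
  exact sub_zero (0 : (ℤ →₀ 𝕂) →ₗ[𝕂] (ℤ →₀ 𝕂))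

lemma Fop_serre (h₁ : (1 : ZMod n) ≠ 0) (h₂ : (2 : ZMod n) ≠ 0) (c : 𝕂) (i j : ℤ) :
    Fop 𝕂 n i ∘ₗ Fop 𝕂 n i ∘ₗ Fop 𝕂 n j - c • (Fop 𝕂 n i ∘ₗ Fop 𝕂 n j ∘ₗ Fop 𝕂 n i) +
      Fop 𝕂 n j ∘ₗ Fop 𝕂 n i ∘ₗ Fop 𝕂 n i = 0 := by
  have hii : Fop 𝕂 n i ∘ₗ Fop 𝕂 n i = 0 := Fop_comp_Fop_eq_zero (by simpa using h₁)
  have hiji : Fop 𝕂 n i ∘ₗ Fop 𝕂 n j ∘ₗ Fop 𝕂 n i = 0 := by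
    by_cases h : (i : ZMod n) = (j : ZMod n) + 1
    · rw [Fop_comp_Fop_eq_zero (i := j) (j := i) (by grind), LinearMap.comp_zero]
    · rw [← LinearMap.comp_assoc, Fop_comp_Fop_eq_zero h, LinearMap.zero_comp]
  rw [hiji, hii, ← LinearMap.comp_assoc, hii, LinearMap.zero_comp, LinearMap.comp_zero, smul_zero,
    add_zero]
  exact sub_zero (0 : (ℤ →₀ 𝕂) →ₗ[𝕂] (ℤ →₀ 𝕂))

end EvaluationOperators

theorem evaluation_module_quantum_affine_sln_relations (hn : 3 ≤ n) (hq : q ≠ 0) :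
    (∀ i : ℤ, Kop 𝕂 n q i ∘ₗ Kinv 𝕂 n q i = LinearMap.id ∧
      Kinv 𝕂 n q i ∘ₗ Kop 𝕂 n q i = LinearMap.id) ∧
    (∀ i j : ℤ, Kop 𝕂 n q i ∘ₗ Kop 𝕂 n q j = Kop 𝕂 n q j ∘ₗ Kop 𝕂 n q i) ∧
    (∀ i j : ℤ, Kop 𝕂 n q i ∘ₗ Eop 𝕂 n j ∘ₗ Kinv 𝕂 n q i =
      (q ^ cartan n i j) • Eop 𝕂 n j) ∧
    (∀ i j : ℤ, Kop 𝕂 n q i ∘ₗ Fop 𝕂 n j ∘ₗ Kinv 𝕂 n q i =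
      (q ^ (-cartan n i j)) • Fop 𝕂 n j) ∧
    (∀ i j : ℤ, (q - q⁻¹) • (Eop 𝕂 n i ∘ₗ Fop 𝕂 n j - Fop 𝕂 n j ∘ₗ Eop 𝕂 n i) =
      if (i : ZMod n) = (j : ZMod n) then Kop 𝕂 n q i - Kinv 𝕂 n q i else 0) ∧
    (∀ i j : ℤ, ((j : ZMod n) = (i : ZMod n) + 1 ∨ (j : ZMod n) = (i : ZMod n) - 1) →
      Eop 𝕂 n i ∘ₗ Eop 𝕂 n i ∘ₗ Eop 𝕂 n j -
        (q + q⁻¹) • (Eop 𝕂 n i ∘ₗ Eop 𝕂 n j ∘ₗ Eop 𝕂 n i) +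
        Eop 𝕂 n j ∘ₗ Eop 𝕂 n i ∘ₗ Eop 𝕂 n i = 0) ∧
    (∀ i j : ℤ, ((j : ZMod n) = (i : ZMod n) + 1 ∨ (j : ZMod n) = (i : ZMod n) - 1) →
      Fop 𝕂 n i ∘ₗ Fop 𝕂 n i ∘ₗ Fop 𝕂 n j -
        (q + q⁻¹) • (Fop 𝕂 n i ∘ₗ Fop 𝕂 n j ∘ₗ Fop 𝕂 n i) +
        Fop 𝕂 n j ∘ₗ Fop 𝕂 n i ∘ₗ Fop 𝕂 n i = 0) ∧
    (∀ i j : ℤ, (j : ZMod n) ≠ (i : ZMod n) → (j : ZMod n) ≠ (i : ZMod n) + 1 →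
      (j : ZMod n) ≠ (i : ZMod n) - 1 →
      Eop 𝕂 n i ∘ₗ Eop 𝕂 n j = Eop 𝕂 n j ∘ₗ Eop 𝕂 n i ∧
      Fop 𝕂 n i ∘ₗ Fop 𝕂 n j = Fop 𝕂 n j ∘ₗ Fop 𝕂 n i) := by
  have natCast_ne_zero {k : ℕ} (hk : 0 < k) (hkn : k < n) : (k : ZMod n) ≠ 0 := by
    rw [Ne, ZMod.natCast_eq_zero_iff]
    exact Nat.not_dvd_of_pos_of_lt hk hkn
  have h₁ : (1 : ZMod n) ≠ 0 := by
    simpa using natCast_ne_zero one_pos (by lia)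
  have h₂ : (2 : ZMod n) ≠ 0 := by
    simpa using natCast_ne_zero two_pos (by lia)
  refine ⟨fun i => ⟨Kop_comp_Kinv hq i, Kinv_comp_Kop hq i⟩, Kop_comp_comm,
    Kop_comp_Eop_comp_Kinv hq, Kop_comp_Fop_comp_Kinv hq, Eop_Fop_commutator h₁,
    fun i j _ => Eop_serre h₁ h₂ _ i j, fun i j _ => Fop_serre h₁ h₂ _ i j,
    fun i j _ hadd hsub => ?_⟩
  have hsub' : (i : ZMod n) ≠ (j : ZMod n) + 1 := fun h => hsub (eq_sub_of_add_eq h.symm)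
  exact ⟨(Eop_comp_Eop_eq_zero hadd).trans (Eop_comp_Eop_eq_zero hsub').symm,
    (Fop_comp_Fop_eq_zero hsub').trans (Fop_comp_Fop_eq_zero hadd).symm⟩

end
end

section
/- For each 1 ≤ i ≤ d−1, the operator T_i on M satisfies the Hecke quadratic relation T_i² = (q² − 1)·T_i + q²·id. -/
/-!
STATEMENT 6. The Hecke operator `T_i` on `M = V^{⊗d} ⊗ L` satisfies the quadratic relation
`T_i² = (q² - 1) T_i + q² id`.
`V` has basis `v_1, …, v_n` indexed here by `Fin n`; `M` is modeled as functions from the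
basis `Fin d → Fin n` of `V^{⊗d}` to the coefficient ring.  The Laurent polynomial ring
`L = 𝕂[z_1^{±1}, …, z_d^{±1}]` is embedded in the field `K` of rational functions
(the fraction field of `𝕂[z_1, …, z_d]`), where the divisions defining `∂_i` and `π_i`
are available; the operator `T_i` is given there by the very same formulas, and the
relation on `V^{⊗d} ⊗ K` restricts to `M`.
-/

noncomputable section

open MvPolynomial

variable (𝕂 : Type*) [Field 𝕂] (q : 𝕂) (n d : ℕ)

/-- The field of rational functions in `z_1, …, z_d`. -/
abbrev KF := FractionRing (MvPolynomial (Fin d) 𝕂)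

/-- The variable `z_i` as a rational function. -/
def zvar (i : Fin d) : KF 𝕂 d := algebraMap (MvPolynomial (Fin d) 𝕂) (KF 𝕂 d) (X i)

/-- The scalar `q` as a rational function. -/
def qK : KF 𝕂 d := algebraMap (MvPolynomial (Fin d) 𝕂) (KF 𝕂 d) (C q)

/-- The field automorphism `s_{ij}` exchanging the variables `z_i` and `z_j`. -/
def sSwap (i j : Fin d) : KF 𝕂 d ≃+* KF 𝕂 d :=
  IsFractionRing.ringEquivOfRingEquiv (MvPolynomial.renameEquiv 𝕂 (Equiv.swap i j)).toRingEquiv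

/-- `M = V^{⊗d} ⊗ L`, as functions from the basis `Fin d → Fin n` of `V^{⊗d}`
to the coefficient field. -/
abbrev MS := (Fin d → Fin n) → KF 𝕂 d

/-- The contribution of the basis tensor `x = v_{m_1} ⊗ ⋯ ⊗ v_{m_d}` with coefficient `f`
to `T_i`. -/
def heckeContrib (i : ℕ) (hi : i + 1 < d) (m : Fin d → Fin n) (f : KF 𝕂 d) : MS 𝕂 n d :=
  let i0 : Fin d := ⟨i, by omega⟩
  let i1 : Fin d := ⟨i + 1, hi⟩
  let f' := sSwap 𝕂 d i0 i1 f
  let dpart := (zvar 𝕂 d i1 * f' - zvar 𝕂 d i0 * f) / (zvar 𝕂 d i0 - zvar 𝕂 d i1)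
  let ppart := zvar 𝕂 d i0 * (f' - f) / (zvar 𝕂 d i0 - zvar 𝕂 d i1)
  if m i0 < m i1 then
    (-(qK 𝕂 q d)) • Pi.single (m ∘ Equiv.swap i0 i1) f'
      - ((qK 𝕂 q d) ^ 2 - 1) • Pi.single m dpart
  else if m i0 = m i1 then
    -(Pi.single m f') - ((qK 𝕂 q d) ^ 2 - 1) • Pi.single m ppart
  else
    (-(qK 𝕂 q d)) • Pi.single (m ∘ Equiv.swap i0 i1) f'
      - ((qK 𝕂 q d) ^ 2 - 1) • Pi.single m ppart

/-- The Hecke operator `T_i` on `M`. -/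
def heckeT (i : ℕ) (hi : i + 1 < d) (ψ : MS 𝕂 n d) : MS 𝕂 n d :=
  ∑ m : Fin d → Fin n, heckeContrib 𝕂 q n d i hi m (ψ m)

variable {𝕂 n d}

theorem sSwap_algebraMap (i j : Fin d) (p : MvPolynomial (Fin d) 𝕂) :
    sSwap 𝕂 d i j (algebraMap _ (KF 𝕂 d) p) =
      algebraMap _ (KF 𝕂 d) (rename (Equiv.swap i j) p) := by
  simp [sSwap]

theorem sSwap_zvar_left (i j : Fin d) : sSwap 𝕂 d i j (zvar 𝕂 d i) = zvar 𝕂 d j := by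
  simp [zvar, sSwap_algebraMap]

theorem sSwap_zvar_right (i j : Fin d) : sSwap 𝕂 d i j (zvar 𝕂 d j) = zvar 𝕂 d i := by
  simp [zvar, sSwap_algebraMap]

theorem sSwap_qK (i j : Fin d) : sSwap 𝕂 d i j (qK 𝕂 q d) = qK 𝕂 q d := by
  rw [qK, sSwap_algebraMap, rename_C]

theorem sSwap_sSwap (i j : Fin d) (f : KF 𝕂 d) : sSwap 𝕂 d i j (sSwap 𝕂 d i j f) = f := by
  obtain ⟨a, b, -, rfl⟩ := IsFractionRing.div_surjective (A := MvPolynomial (Fin d) 𝕂) f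
  have hswap : ⇑(Equiv.swap i j) ∘ ⇑(Equiv.swap i j) = id := by
    ext k; simp
  simp only [map_div₀, sSwap_algebraMap, rename_rename, hswap, rename_id_apply]

theorem zvar_sub_zvar_ne_zero {i j : Fin d} (hij : i ≠ j) : zvar 𝕂 d i - zvar 𝕂 d j ≠ 0 := by
  rw [sub_ne_zero]
  intro h
  exact hij (X_injective (IsFractionRing.injective (MvPolynomial (Fin d) 𝕂) (KF 𝕂 d) h))

/-- A sum of basis tensors, some with two factors exchanged, evaluated at a basis tensor. -/
theorem sum_single_comp_swap_add_single_apply (i j : Fin d) (A B : MS 𝕂 n d) (p : Fin d → Fin n) :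
    (∑ m : Fin d → Fin n,
      (Pi.single (m ∘ Equiv.swap i j) (A m) + Pi.single m (B m)) : MS 𝕂 n d) p =
      A (p ∘ Equiv.swap i j) + B p := by
  have hswap : ∀ m : Fin d → Fin n, p = m ∘ Equiv.swap i j ↔ p ∘ Equiv.swap i j = m := by
    intro m
    constructor <;> rintro rfl <;> ext k <;> simp
  simp [Finset.sum_apply, Finset.sum_add_distrib, Pi.single_apply, hswap]

theorem heckeT_apply (i : ℕ) (hi : i + 1 < d) (ψ : MS 𝕂 n d) (p : Fin d → Fin n)
    (i0 i1 : Fin d) (h0 : i0 = ⟨i, by omega⟩) (h1 : i1 = ⟨i + 1, hi⟩) :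
    heckeT 𝕂 q n d i hi ψ p =
      (if p i0 = p i1 then -1 else -qK 𝕂 q d) *
          sSwap 𝕂 d i0 i1 (ψ (p ∘ Equiv.swap i0 i1)) -
        ((qK 𝕂 q d) ^ 2 - 1) *
          ((if p i0 < p i1 then
              zvar 𝕂 d i1 * sSwap 𝕂 d i0 i1 (ψ p) - zvar 𝕂 d i0 * ψ p
            else zvar 𝕂 d i0 * (sSwap 𝕂 d i0 i1 (ψ p) - ψ p)) /
            (zvar 𝕂 d i0 - zvar 𝕂 d i1)) := by
  have key := sum_single_comp_swap_add_single_apply i0 i1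
    (fun m => (if m i0 = m i1 then -1 else -qK 𝕂 q d) * sSwap 𝕂 d i0 i1 (ψ m))
    (fun m => -(((qK 𝕂 q d) ^ 2 - 1) *
      ((if m i0 < m i1 then zvar 𝕂 d i1 * sSwap 𝕂 d i0 i1 (ψ m) - zvar 𝕂 d i0 * ψ m
        else zvar 𝕂 d i0 * (sSwap 𝕂 d i0 i1 (ψ m) - ψ m)) /
        (zvar 𝕂 d i0 - zvar 𝕂 d i1)))) p
  simp only [Function.comp_apply, Equiv.swap_apply_left, Equiv.swap_apply_right,
    eq_comm (a := p i1)] at key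
  rw [sub_eq_add_neg, ← key, heckeT]
  refine congrFun (Finset.sum_congr rfl fun m _ => ?_) p
  subst h0 h1
  simp only [heckeContrib]
  split_ifs with hlt heq heq
  · exact absurd heq hlt.ne
  · simp only [← Pi.single_smul, smul_eq_mul, sub_eq_add_neg, Pi.single_neg]
  · have hfix : m ∘ Equiv.swap (⟨i, by omega⟩ : Fin d) ⟨i + 1, hi⟩ = m := by
      ext k
      rw [Function.comp_apply, Equiv.swap_apply_def]
      split_ifs with hk hk' <;> simp_all
    simp only [hfix, ← Pi.single_smul, smul_eq_mul, sub_eq_add_neg, Pi.single_neg, neg_mul, one_mul]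
  · simp only [← Pi.single_smul, smul_eq_mul, sub_eq_add_neg, Pi.single_neg]

variable (𝕂 n d)

theorem heckeT_quadratic_relation (hn : 1 ≤ n) (hd : 2 ≤ d)
    (i : ℕ) (hi1 : 1 ≤ i + 1) (hi : i + 1 < d) (ψ : MS 𝕂 n d) :
    heckeT 𝕂 q n d i hi (heckeT 𝕂 q n d i hi ψ) =
      ((qK 𝕂 q d) ^ 2 - 1) • heckeT 𝕂 q n d i hi ψ + ((qK 𝕂 q d) ^ 2) • ψ := by
  set i0 : Fin d := ⟨i, by omega⟩ with h0
  set i1 : Fin d := ⟨i + 1, hi⟩ with h1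
  have hne : i0 ≠ i1 := by simp [h0, h1]
  have hD := zvar_sub_zvar_ne_zero (𝕂 := 𝕂) hne
  have hD' := zvar_sub_zvar_ne_zero (𝕂 := 𝕂) hne.symm
  have hT := fun φ p => heckeT_apply (𝕂 := 𝕂) q (n := n) i hi φ p i0 i1 h0 h1
  ext p
  have hpp : (p ∘ Equiv.swap i0 i1) ∘ Equiv.swap i0 i1 = p := by ext k; simp
  simp only [Pi.add_apply, Pi.smul_apply, smul_eq_mul, hT, hpp, Function.comp_apply,
    Equiv.swap_apply_left, Equiv.swap_apply_right]
  rcases lt_trichotomy (p i0) (p i1) with h | h | h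
  · simp only [h, h.ne, h.ne', h.not_gt, if_true, if_false, map_sub, map_mul, map_div₀, map_neg,
      map_pow, map_one, sSwap_qK, sSwap_zvar_left, sSwap_zvar_right, sSwap_sSwap]
    field_simp
    ring
  · have hp : p ∘ Equiv.swap i0 i1 = p := by
      ext k
      rw [Function.comp_apply, Equiv.swap_apply_def]
      split_ifs with hk hk' <;> simp_all
    simp only [h, hp, lt_irrefl, if_true, if_false, map_sub, map_mul, map_div₀, map_neg,
      map_pow, map_one, sSwap_qK, sSwap_zvar_left, sSwap_zvar_right, sSwap_sSwap]
    field_simp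
    ring
  · simp only [h, h.ne, h.ne', h.not_gt, if_true, if_false, map_sub, map_mul, map_div₀, map_neg,
      map_pow, map_one, sSwap_qK, sSwap_zvar_left, sSwap_zvar_right, sSwap_sSwap]
    field_simp
    ring

end
end

section
/- Let n ≥ 2, N ≥ 1, and d = nN. For k ∈ {1,…,d} write k − 1 = n·a_k + b_k with 0 ≤ b_k ≤ n−1, and set u_k = v_{n−b_k} ∈ V. Define w ∈ V^{⊗d} ⊗ ℂ[z_1,…,z_d] by w = Σ_{σ ∈ S_d} sgn(σ)·(∏_{r=1}^{d} z_r^{a_{σ(r)}})·u_{σ(1)} ⊗ ⋯ ⊗ u_{σ(d)}. Then for every i ∈ {1,…,d}: (n+1)·(∏_{j≠i}(z_i − z_j))·∂w/∂z_i = Σ_{j≠i} (∏_{k≠i,j}(z_i − z_k))·(P_{ij} + id)(w). This polynomial identity is precisely equivalent to the statement that F(z_1,…,z_d) = ∏_{1≤i<j≤d}(z_i − z_j)^{−1/n}·w satisfies the sl_n Knizhnik–Zamolodchikov system (∂/∂z_i − (1/(n+1))·Σ_{j≠i} t_{ij}/(z_i − z_j))·F = 0 with t_{ij} = P_{ij}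 − (1/n)·id. -/
/-!
STATEMENT 9. The polynomial identity equivalent to the fact that
`F = ∏_{i<j} (z_i - z_j)^{-1/n} · w` solves the `sl_n` KZ system, where `w` is the finite
antisymmetrization (finite wedge) `v_n ∧ ⋯ ∧ v_1 ∧ z v_n ∧ ⋯ ∧ z^{N-1} v_n ∧ ⋯ ∧ z^{N-1} v_1`.
`V^{⊗ d} ⊗ ℂ[z_1, …, z_d]` is modeled as functions from the basis `Fin d → Fin n` of `V^{⊗ d}`
(the basis vector `v_{b+1}` of `V = ℂ^n` corresponding to `b : Fin n`) to `MvPolynomial (Fin d) ℂ`.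
Indices `k : Fin d` are `0`-based, so `k` corresponds to the paper's `k + 1`, `a_k = k / n`,
`b_k = k % n`, and `u_k = v_{n - b_k}` has `Fin n`-index `n - 1 - k % n`.
-/

open MvPolynomial

noncomputable section

variable (n N : ℕ)

/-- The `Fin n`-index of `u_k = v_{n - b_k}`. -/
def uIdx (hn : 0 < n) (k : Fin (n * N)) : Fin n :=
  ⟨n - 1 - (k : ℕ) % n, by omega⟩

/-- The exponent `a_k = (k - 1)/n` (with `0`-based `k`). -/
def aexp (k : Fin (n * N)) : ℕ := (k : ℕ) / n

/-- The finite wedge `w = Σ_{σ ∈ S_d} sgn(σ) (∏_r z_r^{a_{σ(r)}}) u_{σ(1)} ⊗ ⋯ ⊗ u_{σ(d)}`. -/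
def wWedge (hn : 0 < n) : (Fin (n * N) → Fin n) → MvPolynomial (Fin (n * N)) ℂ :=
  ∑ σ : Equiv.Perm (Fin (n * N)),
    ((Equiv.Perm.sign σ : ℤ)) •
      Pi.single (fun r => uIdx n N hn (σ r)) (∏ r : Fin (n * N), (X r) ^ aexp n N (σ r))

/-- The operator `P_{ij}` exchanging the `i`-th and `j`-th tensor factors. -/
def Pswap (i j : Fin (n * N)) (ψ : (Fin (n * N) → Fin n) → MvPolynomial (Fin (n * N)) ℂ) :
    (Fin (n * N) → Fin n) → MvPolynomial (Fin (n * N)) ℂ :=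
  fun m => ψ (m ∘ (Equiv.swap i j))

/-- Componentwise partial derivative `∂/∂z_i`. -/
def Dz (i : Fin (n * N)) (ψ : (Fin (n * N) → Fin n) → MvPolynomial (Fin (n * N)) ℂ) :
    (Fin (n * N) → Fin n) → MvPolynomial (Fin (n * N)) ℂ :=
  fun m => pderiv i (ψ m)

section Interpolation

open Finset Polynomial

variable {K ι : Type*} [Field K] [DecidableEq ι]

/-- The logarithmic derivative of a Lagrange basis polynomial. -/
theorem Lagrange.eval_derivative_basis (s : Finset ι) (v : ι → K) (j : ι) (x : K)
    (hx : ∀ l ∈ s.erase j, x ≠ v l) :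
    (derivative (Lagrange.basis s v j)).eval x =
      (Lagrange.basis s v j).eval x * ∑ l ∈ s.erase j, 1 / (x - v l) := by
  rw [Lagrange.basis, derivative_prod_finset, eval_finsetSum, mul_sum]
  refine sum_congr rfl fun l hl => ?_
  have hxl : x - v l ≠ 0 := sub_ne_zero.mpr (hx l hl)
  rw [← mul_prod_erase _ _ hl]
  simp only [Lagrange.basisDivisor, derivative_mul, derivative_C, derivative_sub, derivative_X,
    Polynomial.eval_mul, Polynomial.eval_C, Polynomial.eval_sub, Polynomial.eval_X,
    zero_mul, zero_add, sub_zero, mul_one]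
  field_simp

/-- A polynomial of low degree vanishing at all nodes but one is a multiple of the
corresponding Lagrange basis polynomial. -/
theorem Lagrange.eq_C_mul_basis {s : Finset ι} {v : ι → K} (hv : Set.InjOn v s) {p : K[X]}
    (hp : p.degree < #s) {j : ι} (hj : j ∈ s) (h0 : ∀ l ∈ s, l ≠ j → p.eval (v l) = 0) :
    p = Polynomial.C (p.eval (v j)) * Lagrange.basis s v j := by
  conv_lhs => rw [Lagrange.eq_interpolate hv hp, Lagrange.interpolate_apply]
  rw [sum_eq_single_of_mem j hj fun l hl hlj => by rw [h0 l hl hlj, Polynomial.C_0, zero_mul]]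

/-- The derivative of an interpolated polynomial away from the nodes. -/
theorem Lagrange.eval_derivative_eq_sum {s : Finset ι} {v : ι → K} (hv : Set.InjOn v s) {p : K[X]}
    (hp : p.degree < #s) {x : K} (hx : ∀ l ∈ s, x ≠ v l) :
    (derivative p).eval x = ∑ l ∈ s,
      (p.eval x - p.eval (v l) * (Lagrange.basis s v l).eval x) / (x - v l) := by
  have hev (y : K) : p.eval y = ∑ l ∈ s, p.eval (v l) * (Lagrange.basis s v l).eval y := by
    conv_lhs => rw [Lagrange.eq_interpolate hv hp, Lagrange.interpolate_apply]
    simp [eval_finsetSum]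
  calc (derivative p).eval x
      = ∑ j ∈ s, ∑ l ∈ s.erase j,
          p.eval (v j) * (Lagrange.basis s v j).eval x * (1 / (x - v l)) := by
        conv_lhs => rw [Lagrange.eq_interpolate hv hp, Lagrange.interpolate_apply]
        rw [derivative_sum, eval_finsetSum]
        refine sum_congr rfl fun j hj => ?_
        rw [derivative_C_mul, Polynomial.eval_mul, Polynomial.eval_C,
          Lagrange.eval_derivative_basis s v j x fun l hl => hx l (mem_of_mem_erase hl),
          ← mul_assoc, mul_sum]
    _ = ∑ l ∈ s, ∑ j ∈ s.erase l,
          p.eval (v j) * (Lagrange.basis s v j).eval x * (1 / (x - v l)) :=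
        sum_comm' fun j l => by simp only [mem_erase]; tauto
    _ = _ := by
        refine sum_congr rfl fun l hl => ?_
        rw [← sum_mul, hev x, ← add_sum_erase _ _ hl, add_sub_cancel_left, mul_one_div]

end Interpolation

section Derivations

open Finset

variable {R A : Type*} [CommRing R] [CommRing A] [Algebra R A]

theorem Derivation.prod_eq_zero {ι : Type*} (D : Derivation R A A) (s : Finset ι) (f : ι → A)
    (h : ∀ i ∈ s, D (f i) = 0) : D (∏ i ∈ s, f i) = 0 := by
  classical
  induction s using Finset.induction_on with
  | empty => simp
  | insert i s hi ih =>
    rw [prod_insert hi, D.leibniz, h i (mem_insert_self i s),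
      ih fun j hj => h j (mem_insert_of_mem hj), smul_zero, smul_zero, add_zero]

variable {ι : Type*} [Fintype ι] [DecidableEq ι]

theorem Derivation.det_eq_zero (D : Derivation R A A) (M : Matrix ι ι A)
    (h : ∀ r k, D (M r k) = 0) : D M.det = 0 := by
  rw [Matrix.det_apply, map_sum]
  refine sum_eq_zero fun σ _ => ?_
  rw [Units.smul_def, map_zsmul, D.prod_eq_zero _ _ fun r _ => h _ _, smul_zero]

/-- Differentiating a determinant all of whose rows but one consist of constants. -/
theorem Derivation.det_eq_sum (D : Derivation R A A) (M : Matrix ι ι A) (i : ι)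
    (h : ∀ r, r ≠ i → ∀ k, D (M r k) = 0) :
    D M.det = ∑ k, D (M i k) * M.adjugate k i := by
  rw [M.det_eq_sum_mul_adjugate_row i, map_sum]
  refine sum_congr rfl fun k _ => ?_
  have h0 : D (M.adjugate k i) = 0 := by
    rw [Matrix.adjugate_apply]
    refine D.det_eq_zero _ fun r l => ?_
    rcases eq_or_ne r i with rfl | hr
    · rw [Matrix.updateRow_self]
      rcases eq_or_ne l k with rfl | hl
      · simp
      · simp [hl]
    · rw [Matrix.updateRow_ne hr, h r hr]
  rw [D.leibniz, h0, smul_zero, zero_add, smul_eq_mul, mul_comm]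

theorem Matrix.det_updateRow_eq_sum_mul_adjugate (M : Matrix ι ι A) (i : ι) (b : ι → A) :
    (M.updateRow i b).det = ∑ k, b k * M.adjugate k i := by
  rw [(M.updateRow i b).det_eq_sum_mul_adjugate_row i]
  refine sum_congr rfl fun k _ => ?_
  rw [Matrix.updateRow_self, Matrix.adjugate_apply, Matrix.adjugate_apply]
  congr 2
  ext r l
  rcases eq_or_ne r i with rfl | hr
  · simp
  · simp [hr]

end Derivations

section ColoredVandermonde

open Finset Polynomial

variable {ι C : Type*} [Fintype ι] [DecidableEq ι] [DecidableEq C]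

/-- The coordinates of `x ^ a k` placed in the columns of colour `c`. -/
def colorRow {R : Type*} [CommRing R] (u : ι → C) (a : ι → ℕ) (c : C) (x : R) : ι → R :=
  fun k => if u k = c then x ^ a k else 0

/-- The matrix whose `r`-th row is the row of colour `m r` at the point `z r`. -/
def colorMatrix {R : Type*} [CommRing R] (u : ι → C) (a : ι → ℕ) (z : ι → R) (m : ι → C) :
    Matrix ι ι R :=
  Matrix.of fun r => colorRow u a (m r) (z r)

theorem map_colorMatrix {κ R S : Type*} [CommRing R] [CommRing S] (u : κ → C) (a : κ → ℕ)
    (z : κ → R) (m : κ → C) (f : R →+* S) :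
    (colorMatrix u a z m).map f = colorMatrix u a (fun r => f (z r)) m := by
  ext r k
  simp only [colorMatrix, colorRow, Matrix.map_apply, Matrix.of_apply]
  split_ifs
  · exact map_pow f _ _
  · exact map_zero f

/-- The determinant of `A`, with row `i` replaced by the row of colour `c` at a variable point. -/
def rowPoly {R : Type*} [CommRing R] (u : ι → C) (a : ι → ℕ) (A : Matrix ι ι R) (i : ι) (c : C) :
    R[X] :=
  ∑ k, if u k = c then Polynomial.C (A.adjugate k i) * Polynomial.X ^ a k else 0

section CommRing

variable {R : Type*} [CommRing R] (u : ι → C) (a : ι → ℕ)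

theorem eval_rowPoly (A : Matrix ι ι R) (i : ι) (c : C) (x : R) :
    (rowPoly u a A i c).eval x = (A.updateRow i (colorRow u a c x)).det := by
  rw [Matrix.det_updateRow_eq_sum_mul_adjugate, rowPoly, eval_finsetSum]
  refine sum_congr rfl fun k _ => ?_
  rw [colorRow]
  split_ifs
  · rw [Polynomial.eval_mul, Polynomial.eval_C, Polynomial.eval_pow, Polynomial.eval_X, mul_comm]
  · rw [Polynomial.eval_zero, zero_mul]

theorem degree_rowPoly_lt {N : ℕ} (ha : ∀ k, a k < N) (A : Matrix ι ι R) (i : ι) (c : C) :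
    (rowPoly u a A i c).degree < N := by
  rw [← mem_degreeLT]
  refine sum_mem fun k _ => ?_
  split_ifs
  · rw [mem_degreeLT]
    exact (Polynomial.degree_C_mul_X_pow_le _ _).trans_lt (by exact_mod_cast ha k)
  · exact zero_mem _

theorem eval_derivative_rowPoly (A : Matrix ι ι R) (i : ι) (c : C) (x : R) :
    (derivative (rowPoly u a A i c)).eval x =
      ∑ k, (if u k = c then (a k : R) * x ^ (a k - 1) else 0) * A.adjugate k i := by
  rw [rowPoly, derivative_sum, eval_finsetSum]
  refine sum_congr rfl fun k _ => ?_
  split_ifs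
  · simp [derivative_X_pow]
    ring
  · simp

variable (z : ι → R) (m : ι → C)

theorem eval_rowPoly_self (i : ι) :
    (rowPoly u a (colorMatrix u a z m) i (m i)).eval (z i) = (colorMatrix u a z m).det := by
  rw [eval_rowPoly]
  exact congrArg Matrix.det (Matrix.updateRow_eq_self (colorMatrix u a z m) i)

/-- Exchanging two colours amounts, up to sign, to exchanging the corresponding points. -/
theorem det_colorMatrix_comp_swap {i j : ι} (hij : i ≠ j) :
    (colorMatrix u a z (m ∘ Equiv.swap i j)).det =
      -(((colorMatrix u a z m).updateRow i (colorRow u a (m i) (z j))).updateRow j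
        (colorRow u a (m j) (z i))).det := by
  have h : colorMatrix u a z (m ∘ Equiv.swap i j) =
      ((((colorMatrix u a z m).updateRow i (colorRow u a (m i) (z j))).updateRow j
        (colorRow u a (m j) (z i)))).submatrix (Equiv.swap i j) id := by
    ext r k
    rcases eq_or_ne r i with rfl | hri
    · simp [colorMatrix]
    rcases eq_or_ne r j with rfl | hrj
    · simp [colorMatrix, Matrix.updateRow_ne hij]
    · simp [colorMatrix, Equiv.swap_apply_of_ne_of_ne hri hrj, Matrix.updateRow_ne hrj,
        Matrix.updateRow_ne hri]
  rw [h, Matrix.det_permute, Equiv.Perm.sign_swap hij]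
  simp

theorem map_det_colorMatrix {S : Type*} [CommRing S] (f : R →+* S) :
    f (colorMatrix u a z m).det = (colorMatrix u a (fun r => f (z r)) m).det := by
  rw [f.map_det, RingHom.mapMatrix_apply, map_colorMatrix]

theorem map_eval_derivative_rowPoly {S : Type*} [CommRing S] (f : R →+* S) (i : ι) (c : C) (x : R) :
    f ((derivative (rowPoly u a (colorMatrix u a z m) i c)).eval x) =
      (derivative (rowPoly u a (colorMatrix u a (fun r => f (z r)) m) i c)).eval (f x) := by
  rw [eval_derivative_rowPoly, eval_derivative_rowPoly, map_sum]
  refine sum_congr rfl fun k _ => ?_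
  have hadj : f ((colorMatrix u a z m).adjugate k i) =
      (colorMatrix u a (fun r => f (z r)) m).adjugate k i := by
    rw [← map_colorMatrix u a z m f, ← RingHom.mapMatrix_apply, ← f.map_adjugate]
    rfl
  rw [map_mul, hadj]
  split_ifs <;> simp

end CommRing

variable {K : Type*} [Field K] {u : ι → C} {a : ι → ℕ} {z : ι → K} {m : ι → C} {N : ℕ}

theorem det_colorMatrix_swap_eq_basis (hz : Function.Injective z) (ha : ∀ k, a k < N)
    (hm : ∀ c, #{r | m r = c} = N) {i j : ι} (hij : m j ≠ m i) :
    (colorMatrix u a z (m ∘ Equiv.swap i j)).det =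
      -((rowPoly u a (colorMatrix u a z m) i (m i)).eval (z j) *
        (Lagrange.basis ({r | m r = m j} : Finset ι) z j).eval (z i)) := by
  have hne : i ≠ j := fun h => hij (by rw [h])
  set A := (colorMatrix u a z m).updateRow i (colorRow u a (m i) (z j)) with hA
  have hAl {l : ι} (hl : l ≠ i) : A l = colorRow u a (m l) (z l) := Matrix.updateRow_ne hl
  have hp := Lagrange.eq_C_mul_basis (s := ({r | m r = m j} : Finset ι)) (v := z) (j := j)
    (p := rowPoly u a A j (m j)) hz.injOn (by rw [hm]; exact degree_rowPoly_lt u a ha _ _ _)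
    (by simp) (fun l hl hlj => by
      have hml : m l = m j := by simpa using hl
      have hli : l ≠ i := fun h => hij (by rw [← h, hml])
      rw [eval_rowPoly, ← hml, ← hAl hli]
      exact Matrix.det_updateRow_eq_zero hlj)
  rw [det_colorMatrix_comp_swap u a z m hne, ← hA, ← eval_rowPoly, hp, Polynomial.eval_mul,
    Polynomial.eval_C, eval_rowPoly, ← hAl hne.symm, Matrix.updateRow_eq_self, hA, eval_rowPoly]

/-- The Knizhnik–Zamolodchikov identity for a balanced colouring, over a field. -/
theorem card_add_one_mul_eval_derivative_rowPoly [Fintype C] (hz : Function.Injective z)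
    (ha : ∀ k, a k < N) (hm : ∀ c, #{r | m r = c} = N) (i : ι) :
    ((Fintype.card C : K) + 1) *
        (derivative (rowPoly u a (colorMatrix u a z m) i (m i))).eval (z i) =
      ∑ j ∈ univ.erase i,
        ((colorMatrix u a z (m ∘ Equiv.swap i j)).det + (colorMatrix u a z m).det) /
          (z i - z j) := by
  set p := rowPoly u a (colorMatrix u a z m) i (m i) with hp
  have hdeg (c : C) : p.degree < #{r | m r = c} := by
    rw [hm]; exact degree_rowPoly_lt u a ha _ _ _
  have hself : p.eval (z i) = (colorMatrix u a z m).det := eval_rowPoly_self u a z m i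
  have hother (c : C) (hc : c ≠ m i) :
      ∑ j ∈ univ.erase i with m j = c,
        ((colorMatrix u a z (m ∘ Equiv.swap i j)).det + (colorMatrix u a z m).det) /
          (z i - z j) = (derivative p).eval (z i) := by
    have hset : ({j ∈ univ.erase i | m j = c} : Finset ι) = ({r | m r = c} : Finset ι) := by
      ext j
      simp only [mem_filter, mem_erase, mem_univ, and_true, true_and, and_iff_right_iff_imp]
      rintro hj rfl
      exact hc hj.symm
    rw [hset, Lagrange.eval_derivative_eq_sum (s := ({r | m r = c} : Finset ι)) hz.injOn (hdeg c)]
    · refine sum_congr rfl fun j hj => ?_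
      obtain rfl : m j = c := by simpa using hj
      rw [det_colorMatrix_swap_eq_basis hz ha hm hc, hself, neg_add_eq_sub]
    · intro l hl h
      have hml : m l = c := by simpa using hl
      rw [← hz h] at hml
      exact hc hml.symm
  have hsame :
      ∑ j ∈ univ.erase i with m j = m i,
        ((colorMatrix u a z (m ∘ Equiv.swap i j)).det + (colorMatrix u a z m).det) /
          (z i - z j) = 2 * (derivative p).eval (z i) := by
    have hb : p = Polynomial.C (p.eval (z i)) *
        Lagrange.basis ({r | m r = m i} : Finset ι) z i := by
      refine Lagrange.eq_C_mul_basis hz.injOn (hdeg _) (by simp) fun l hl hli => ?_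
      have hml : m l = m i := by simpa using hl
      rw [hp, eval_rowPoly, ← hml]
      exact Matrix.det_updateRow_eq_zero (M := colorMatrix u a z m) hli
    have hder : (derivative p).eval (z i) =
        p.eval (z i) * ∑ l ∈ ({r | m r = m i} : Finset ι).erase i, 1 / (z i - z l) := by
      conv_lhs => rw [hb]
      rw [derivative_C_mul, Polynomial.eval_mul, Polynomial.eval_C, Lagrange.eval_derivative_basis,
        Lagrange.eval_basis_self hz.injOn (by simp), one_mul]
      intro l hl h
      exact ne_of_mem_erase hl (hz h).symm
    rw [hder, filter_erase, mul_sum, mul_sum, hself]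
    refine sum_congr rfl fun j hj => ?_
    have hmj : m j = m i := by simpa using mem_of_mem_erase hj
    have hcomp : m ∘ Equiv.swap i j = m := by
      ext r
      simp only [Function.comp_apply, Equiv.swap_apply_def]
      split_ifs with h1 h2
      · rw [h1, hmj]
      · rw [h2, hmj]
      · rfl
    rw [hcomp]
    ring
  rw [← sum_fiberwise (univ.erase i) m, ← add_sum_erase _ _ (mem_univ (m i)), hsame,
    sum_congr rfl fun c hc => hother c (ne_of_mem_erase hc), sum_const,
    card_erase_of_mem (mem_univ _), card_univ, nsmul_eq_mul,
    Nat.cast_sub (Fintype.card_pos_iff.mpr ⟨m i⟩)]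
  push_cast
  ring

end ColoredVandermonde

open Finset in
theorem card_filter_uIdx_eq (hn : 0 < n) (c : Fin n) : #{k | uIdx n N hn k = c} = N := by
  have hc := c.isLt
  symm
  conv_lhs => rw [← Fintype.card_fin N, ← card_univ]
  refine card_bij (fun b _ => ⟨n * b + (n - 1 - c), ?_⟩) ?_ ?_ ?_
  · calc n * b + (n - 1 - c) < n * b + n := by omega
      _ = n * (b + 1) := by ring
      _ ≤ n * N := Nat.mul_le_mul_left n b.isLt
  · intro b _
    simp only [mem_filter, mem_univ, true_and, uIdx, Fin.ext_iff, Nat.mul_add_mod]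
    rw [Nat.mod_eq_of_lt (by omega)]
    omega
  · intro b _ b' _ h
    simp only [Fin.mk.injEq, Nat.add_right_cancel_iff] at h
    exact Fin.ext (Nat.eq_of_mul_eq_mul_left hn h)
  · intro k hk
    simp only [mem_filter, mem_univ, true_and, uIdx, Fin.ext_iff] at hk
    have hmod := Nat.mod_lt (k : ℕ) hn
    refine ⟨⟨k / n, Nat.div_lt_of_lt_mul k.isLt⟩, mem_univ _, Fin.ext ?_⟩
    have hdiv := Nat.div_add_mod (k : ℕ) n
    simp only
    omega

theorem wWedge_apply_eq_det (hn : 0 < n) (m : Fin (n * N) → Fin n) :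
    wWedge n N hn m = (colorMatrix (uIdx n N hn) (aexp n N) X m).det := by
  rw [wWedge, Finset.sum_apply, ← Matrix.det_transpose, Matrix.det_apply]
  refine Finset.sum_congr rfl fun σ _ => ?_
  rw [Pi.smul_apply, Units.smul_def, Pi.single_apply]
  congr 1
  simp only [Matrix.transpose_apply, colorMatrix, Matrix.of_apply, colorRow]
  rw [Finset.prod_ite_zero]
  simp only [funext_iff, Finset.mem_univ, true_implies, eq_comm]

open Finset in
/-- A component of the wedge vanishes unless every basis vector occurs exactly `N` times. -/
theorem wWedge_apply_eq_zero (hn : 0 < n) (m : Fin (n * N) → Fin n)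
    (hm : ¬∀ c, #{r | m r = c} = N) : wWedge n N hn m = 0 := by
  rw [wWedge, Finset.sum_apply]
  refine sum_eq_zero fun σ _ => ?_
  rw [Pi.smul_apply, Pi.single_eq_of_ne, smul_zero]
  rintro rfl
  refine hm fun c => ?_
  exact (card_equiv σ (by simp)).trans (card_filter_uIdx_eq n N hn c)

theorem pderiv_wWedge_apply (hn : 0 < n) (i : Fin (n * N)) (m : Fin (n * N) → Fin n) :
    pderiv i (wWedge n N hn m) =
      (Polynomial.derivative (rowPoly (uIdx n N hn) (aexp n N)
        (colorMatrix (uIdx n N hn) (aexp n N) X m) i (m i))).eval (X i) := by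
  rw [wWedge_apply_eq_det, eval_derivative_rowPoly, Derivation.det_eq_sum]
  · refine Finset.sum_congr rfl fun k _ => ?_
    congr 1
    simp only [colorMatrix, Matrix.of_apply, colorRow]
    split_ifs
    · rw [Derivation.leibniz_pow, pderiv_X_self]
      simp
    · exact map_zero _
  · intro r hr k
    simp only [colorMatrix, Matrix.of_apply, colorRow]
    split_ifs
    · rw [Derivation.leibniz_pow, pderiv_X_of_ne hr]
      simp
    · exact map_zero _

theorem finite_wedge_solves_KZ (hn : 2 ≤ n) (hN : 1 ≤ N) (hn0 : 0 < n) (i : Fin (n * N)) :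
    (n + 1) • ((∏ j ∈ Finset.univ.erase i, (X i - X j : MvPolynomial (Fin (n * N)) ℂ)) •
        Dz n N i (wWedge n N hn0)) =
      ∑ j ∈ Finset.univ.erase i,
        (∏ k ∈ (Finset.univ.erase i).erase j, (X i - X k : MvPolynomial (Fin (n * N)) ℂ)) •
          (Pswap n N i j (wWedge n N hn0) + wWedge n N hn0) := by
  have ha (k : Fin (n * N)) : aexp n N k < N := Nat.div_lt_of_lt_mul k.isLt
  ext1 m
  simp only [Pi.smul_apply, Finset.sum_apply, Pi.add_apply, Pswap, Dz, smul_eq_mul]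
  by_cases hm : ∀ c, Finset.card {r | m r = c} = N
  · let f := algebraMap (MvPolynomial (Fin (n * N)) ℂ) (FractionRing (MvPolynomial (Fin (n * N)) ℂ))
    have hf : Function.Injective f := IsFractionRing.injective _ _
    have hz : Function.Injective fun r => f (X r) := hf.comp (X_injective)
    have hsub {j : Fin (n * N)} (hj : j ∈ Finset.univ.erase i) : f (X i) - f (X j) ≠ 0 :=
      sub_ne_zero.mpr fun h => Finset.ne_of_mem_erase hj (hz h).symm
    apply hf
    have hdet (m' : Fin (n * N) → Fin n) : f (wWedge n N hn0 m') =
        (colorMatrix (uIdx n N hn0) (aexp n N) (fun r => f (X r)) m').det := by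
      rw [wWedge_apply_eq_det, map_det_colorMatrix]
    have hder : f (pderiv i (wWedge n N hn0 m)) = (Polynomial.derivative
        (rowPoly (uIdx n N hn0) (aexp n N)
          (colorMatrix (uIdx n N hn0) (aexp n N) (fun r => f (X r)) m) i (m i))).eval
            (f (X i)) := by
      rw [pderiv_wWedge_apply, map_eval_derivative_rowPoly]
    have key := card_add_one_mul_eval_derivative_rowPoly (u := uIdx n N hn0) hz ha hm i
    rw [Fintype.card_fin] at key
    rw [nsmul_eq_mul, map_mul, map_mul, map_natCast, hder, mul_left_comm, Nat.cast_add,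
      Nat.cast_one, key, map_sum, Finset.mul_sum]
    refine Finset.sum_congr rfl fun j hj => ?_
    rw [map_mul, map_add, hdet, hdet, ← Finset.mul_prod_erase _ _ hj, map_mul, map_sub]
    field_simp [hsub hj]
  · have hswap (j : Fin (n * N)) : wWedge n N hn0 (m ∘ Equiv.swap i j) = 0 := by
      refine wWedge_apply_eq_zero n N hn0 _ fun h => hm fun c => ?_
      exact (Finset.card_equiv (Equiv.swap i j) (by simp)).trans (h c)
    simp [hswap, wWedge_apply_eq_zero n N hn0 m hm]

end
end

section
/- Fix i ∈ ℤ, d ≥ 1, and q ∈ 𝕂. Then, in F^{⊗d}, A_q(v_i, v_{i−1}, …, v_{i−d+1}) = Σ_{j=0}^{d−1} (−q)^j · v_{i−j} ⊗ A_q(v_i, …, v_{i−j+1}, v_{i−j−1}, …, v_{i−d+1}), where the j-th summand omits v_{i−j} from the q-antisymmetrization of the remaining d−1 vectors. (This is the finite form of the proposition Φ_{(i)}(v_{Λ_i}) = v_i ⊗ v_{Λ_{i−1}} + Σ_{j≥1} (−q)^j v_{i−j} ⊗ (v_i ∧_q ⋯ ∧_q v_{i−(j−1)} ∧_q v_{i−(j+1)}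 ∧_q ⋯); at q = 1 it gives the corresponding classical expansion of Φ_{(i)}(v_{Λ_i}).) -/
/-!
STATEMENT 14. First-factor expansion of the `q`-antisymmetrization of the consecutive
basis vectors `v_i, v_{i-1}, …, v_{i-d+1}` of `F`:
`A_q(v_i, …, v_{i-d+1}) = Σ_{j=0}^{d-1} (-q)^j v_{i-j} ⊗ A_q(v_i, …, v̂_{i-j}, …, v_{i-d+1})`.
We work with `d + 1` vectors (`d + 1 ≥ 1`), indexed by `Fin (d+1)`; `F` is modeled as `ℤ →₀ 𝕂`.
-/

open scoped TensorProduct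

/-- The vector space `F` with basis `{v_m}_{m ∈ ℤ}`. -/
def FM (𝕂 : Type*) [Field 𝕂] : Type _ := ℤ →₀ 𝕂

noncomputable instance (𝕂 : Type*) [Field 𝕂] : AddCommGroup (FM 𝕂) :=
  inferInstanceAs (AddCommGroup (ℤ →₀ 𝕂))
noncomputable instance (𝕂 : Type*) [Field 𝕂] : Module 𝕂 (FM 𝕂) :=
  inferInstanceAs (Module 𝕂 (ℤ →₀ 𝕂))

/-- The basis vector `v m`. -/
noncomputable def vb {𝕂 : Type*} [Field 𝕂] (m : ℤ) : FM 𝕂 := Finsupp.single m 1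

/-- The number of inversions (Coxeter length) of a permutation of `Fin d`. -/
def permLength {d : ℕ} (σ : Equiv.Perm (Fin d)) : ℕ :=
  (Finset.univ.filter (fun p : Fin d × Fin d => p.1 < p.2 ∧ σ p.2 < σ p.1)).card

/-- The `q`-antisymmetrization `A_q(x_1, …, x_d) = Σ_{σ ∈ S_d} (-q)^{ℓ(σ)} x_{σ(1)} ⊗ ⋯ ⊗ x_{σ(d)}`. -/
noncomputable def qAntisym (𝕂 : Type*) [Field 𝕂] (q : 𝕂) {d : ℕ} (x : Fin d → FM 𝕂) :
    ⨂[𝕂] _ : Fin d, FM 𝕂 :=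
  ∑ σ : Equiv.Perm (Fin d), (-q) ^ permLength σ • PiTensorProduct.tprod 𝕂 (fun i => x (σ i))

/-- The canonical map `F ⊗ F^{⊗ d} → F^{⊗ (d+1)}`, `x ⊗ (y_1 ⊗ ⋯ ⊗ y_d) ↦ x ⊗ y_1 ⊗ ⋯ ⊗ y_d`,
as a linear map in the second argument for a fixed first argument `x`. -/
noncomputable def insFirst (𝕂 : Type*) [Field 𝕂] {d : ℕ} (x : FM 𝕂) :
    (⨂[𝕂] _ : Fin d, FM 𝕂) →ₗ[𝕂] ⨂[𝕂] _ : Fin (d + 1), FM 𝕂 :=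
  PiTensorProduct.lift ((PiTensorProduct.tprod 𝕂 (s := fun _ : Fin (d + 1) => FM 𝕂)).curryLeft x)

/-- The permutation of `Fin (d + 1)` sending `0` to `j` and acting as `σ`, transported along
`j.succAbove`, on the remaining points. -/
def permCons {d : ℕ} (j : Fin (d + 1)) (σ : Equiv.Perm (Fin d)) : Equiv.Perm (Fin (d + 1)) :=
  j.cycleRange.symm * Equiv.Perm.decomposeFin.symm (0, σ)

@[simp]
theorem permCons_zero {d : ℕ} (j : Fin (d + 1)) (σ : Equiv.Perm (Fin d)) :
    permCons j σ 0 = j := by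
  simp [permCons]

@[simp]
theorem permCons_succ {d : ℕ} (j : Fin (d + 1)) (σ : Equiv.Perm (Fin d)) (k : Fin d) :
    permCons j σ k.succ = j.succAbove (σ k) := by
  simp [permCons]

theorem permCons_bijective (d : ℕ) :
    Function.Bijective
      (fun p : Fin (d + 1) × Equiv.Perm (Fin d) => permCons p.1 p.2) := by
  rw [Fintype.bijective_iff_injective_and_card]
  constructor
  · rintro ⟨j, σ⟩ ⟨j', σ'⟩ h
    have h0 : j = j' := by simpa using DFunLike.congr_fun h 0
    subst h0
    have hσ : σ = σ' := by
      ext1 k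
      simpa using DFunLike.congr_fun h k.succ
    rw [hσ]
  · simp [Fintype.card_perm, Nat.factorial_succ]

theorem sum_castSucc_lt {d : ℕ} (j : Fin (d + 1)) :
    (∑ k : Fin d, if k.castSucc < j then 1 else 0) = (j : ℕ) := by
  have h := Fin.sum_univ_castSucc (fun k : Fin (d + 1) => if k < j then 1 else 0)
  rw [if_neg (Fin.le_last j).not_gt, add_zero] at h
  rw [← h, ← Finset.card_filter, Finset.filter_gt_eq_Iio, Fin.card_Iio]

theorem permLength_eq_sum {d : ℕ} (σ : Equiv.Perm (Fin d)) :
    permLength σ = ∑ a, ∑ b, if a < b ∧ σ b < σ a then 1 else 0 := by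
  rw [permLength, Finset.card_filter, Fintype.sum_prod_type]

theorem permLength_permCons {d : ℕ} (j : Fin (d + 1)) (σ : Equiv.Perm (Fin d)) :
    permLength (permCons j σ) = j + permLength σ := by
  have hj : (∑ k, if (σ k).castSucc < j then 1 else 0) = (j : ℕ) :=
    (Equiv.sum_comp σ fun k => if k.castSucc < j then 1 else 0).trans (sum_castSucc_lt j)
  simp [permLength_eq_sum, Fin.sum_univ_succ, -Finset.sum_boole, Fin.succAbove_lt_iff_castSucc_lt,
    hj]

theorem insFirst_tprod (𝕂 : Type*) [Field 𝕂] {d : ℕ} (x : FM 𝕂) (y : Fin d → FM 𝕂) :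
    insFirst 𝕂 x (PiTensorProduct.tprod 𝕂 y) = PiTensorProduct.tprod 𝕂 (Fin.cons x y) := by
  simp [insFirst]

/-- Expansion of the `q`-antisymmetrization along its first tensor factor. -/
theorem qAntisym_succ (𝕂 : Type*) [Field 𝕂] (q : 𝕂) {d : ℕ} (x : Fin (d + 1) → FM 𝕂) :
    qAntisym 𝕂 q x =
      ∑ j : Fin (d + 1),
        (-q) ^ (j : ℕ) • insFirst 𝕂 (x j) (qAntisym 𝕂 q fun k => x (j.succAbove k)) := by
  rw [qAntisym, ← (permCons_bijective d).sum_comp, Fintype.sum_prod_type]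
  refine Finset.sum_congr rfl fun j _ => ?_
  rw [qAntisym, map_sum, Finset.smul_sum]
  refine Finset.sum_congr rfl fun σ _ => ?_
  rw [map_smul, insFirst_tprod, smul_smul, ← pow_add, permLength_permCons]
  congr 2
  ext k
  cases k using Fin.cases <;> simp

theorem qAntisym_consecutive_first_factor_expansion (𝕂 : Type*) [Field 𝕂] (q : 𝕂)
    (i : ℤ) (d : ℕ) :
    qAntisym 𝕂 q (fun j : Fin (d + 1) => vb (i - (j : ℤ))) =
      ∑ j : Fin (d + 1),
        (-q) ^ (j : ℕ) • insFirst 𝕂 (vb (i - (j : ℤ)))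
          (qAntisym 𝕂 q (fun k : Fin d => vb (i - ((j.succAbove k : Fin (d + 1)) : ℤ)))) := by
  exact qAntisym_succ 𝕂 q _
end
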